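/- arXiv:math/0205110 — 9 statements merged into one kernel-verified Lean document; each statement's English description precedes it below -/
import Mathlib

section
/- Let m be an odd integer with m ≥ 3 and let ζ = exp(2πi/m) ∈ ℂ. Then there are no integers a, b with a ≢ 0 (mod m) and b ≢ 0 (mod m) satisfying ((ζ^a + 1)/(ζ^a − 1)) · ((ζ^b + 1)/(ζ^b − 1)) = 1. -/
theorem eq_neg_of_cayley_mul_cayley_eq_one {K : Type*} [Field K] [NeZero (2 : K)] {x y : K}
    (h : ((x + 1) / (x - 1)) * ((y + 1) / (y - 1)) = 1) : y = -x := by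
  have hx : x - 1 ≠ 0 := fun h0 => by simp [h0] at h
  have hy : y - 1 ≠ 0 := fun h0 => by simp [h0] at h
  rw [div_mul_div_comm, div_eq_one_iff_eq (mul_ne_zero hx hy)] at h
  refine mul_left_cancel₀ (two_ne_zero (α := K)) ?_
  linear_combination h

theorem stmt_3 (m : ℕ) (hm : 3 ≤ m) (hodd : Odd m)
    (ζ : ℂ) (hζ : ζ = Complex.exp (2 * Real.pi * Complex.I / m)) :
    ¬ ∃ a b : ℤ, ¬ a ≡ 0 [ZMOD (m : ℤ)] ∧ ¬ b ≡ 0 [ZMOD (m : ℤ)] ∧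
      ((ζ ^ a + 1) / (ζ ^ a - 1)) * ((ζ ^ b + 1) / (ζ ^ b - 1)) = 1 := by
  rintro ⟨a, b, -, -, h⟩
  have hζm : ζ ^ m = 1 := hζ ▸ (Complex.isPrimitiveRoot_exp m (by omega)).pow_eq_one
  have hpow (c : ℤ) : (ζ ^ c) ^ m = 1 := by
    rw [← zpow_natCast, zpow_comm, zpow_natCast, hζm, one_zpow]
  have hneg := hpow b
  rw [eq_neg_of_cayley_mul_cayley_eq_one h, hodd.neg_pow, hpow a] at hneg
  norm_num at hneg
end

section
/- Let p be an odd prime, t ≥ 1, m = p^t, and ζ = exp(2πi/m) ∈ ℂ. Suppose a, b, c, d are integers, none congruent to 0 mod m, such that ((ζ^a + 1)/(ζ^a − 1)) · ((ζ^b + 1)/(ζ^b − 1)) = ((ζ^c + 1)/(ζ^c − 1)) · ((ζ^d + 1)/(ζ^d − 1)). Then the unordered pair {c, d} is congruent mod m to {a, b} or to {−a, −b}; that is, (c ≡ a and d ≡ b) or (c ≡ b and d ≡ a) or (c ≡ −a and d ≡ −b) or (c ≡ −b and d ≡ −a), all congruences taken mod m. -/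
open Polynomial in
/-- A polynomial of degree less than `p ^ (s + 1)` vanishing at a primitive `p ^ (s + 1)`-th root of
unity has coefficients that depend only on the exponent modulo `p ^ s`. -/
theorem coeff_add_mul_eq_of_aeval_eq_zero {K : Type*} [Field K] [CharZero K] {p s : ℕ}
    (hp : p.Prime) {ζ : K} (hζ : IsPrimitiveRoot ζ (p ^ (s + 1))) {F : ℤ[X]}
    (hdeg : F.degree < (p ^ (s + 1) : ℕ)) (hF : aeval ζ F = 0) {k j : ℕ} (hk : k < p ^ s)
    (hj : j < p) : F.coeff (k + j * p ^ s) = F.coeff k := by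
  have := Fact.mk hp
  have hpos : 0 < p ^ (s + 1) := pow_pos hp.pos _
  obtain ⟨G, rfl⟩ : cyclotomic (p ^ (s + 1)) ℤ ∣ F := by
    rw [cyclotomic_eq_minpoly hζ hpos]
    exact minpoly.isIntegrallyClosed_dvd (hζ.isIntegral hpos) hF
  have hG : ∀ n, p ^ s ≤ n → G.coeff n = 0 := by
    intro n hn
    by_cases h0 : G = 0
    · simp [h0]
    apply coeff_eq_zero_of_natDegree_lt
    rw [degree_eq_natDegree (mul_ne_zero (cyclotomic_ne_zero _ _) h0), Nat.cast_lt,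
      natDegree_mul (cyclotomic_ne_zero _ _) h0, natDegree_cyclotomic,
      Nat.totient_prime_pow_succ hp, pow_succ] at hdeg
    have : p ^ s * p = p ^ s * (p - 1) + p ^ s := by
      rw [← Nat.mul_succ, Nat.succ_eq_add_one, Nat.sub_add_cancel hp.one_le]
    lia
  have key : ∀ i < p, (cyclotomic (p ^ (s + 1)) ℤ * G).coeff (k + i * p ^ s) = G.coeff k := by
    intro i hi
    rw [cyclotomic_prime_pow_eq_geom_sum hp, Finset.sum_mul, finsetSum_coeff,
      Finset.sum_eq_single_of_mem i (Finset.mem_range.2 hi)]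
    · rw [← pow_mul, coeff_X_pow_mul', if_pos (by rw [mul_comm]; exact Nat.le_add_left _ _)]
      congr 1
      rw [mul_comm, Nat.add_sub_cancel]
    · intro l _ hl
      rw [← pow_mul, coeff_X_pow_mul']
      split_ifs with h
      · apply hG
        rcases lt_or_gt_of_ne hl with hl | hl
        · have := Nat.mul_le_mul_right (p ^ s) (Nat.succ_le_of_lt hl)
          rw [Nat.succ_mul] at this
          rw [mul_comm (p ^ s) l]
          lia
        · have := Nat.mul_le_mul_right (p ^ s) (Nat.succ_le_of_lt hl)
          rw [Nat.succ_mul] at this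
          rw [mul_comm (p ^ s) l] at h
          lia
      · rfl
  have h0 := key 0 hp.pos
  rw [zero_mul, add_zero] at h0
  rw [key j hj, h0]

theorem sum_range_mul_of_periodic {M : Type*} [AddCommMonoid M] {f : ℕ → M} {n q : ℕ}
    (h : ∀ k < q, ∀ j < n, f (k + j * q) = f k) :
    ∑ k ∈ Finset.range (n * q), f k = n • ∑ k ∈ Finset.range q, f k := by
  induction n with
  | zero => simp
  | succ n ih =>
    rw [Nat.succ_mul, Finset.sum_range_add, ih fun k hk j hj => h k hk j (by lia), succ_nsmul]
    congr 1
    refine Finset.sum_congr rfl fun k hk => ?_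
    rw [add_comm, h k (Finset.mem_range.1 hk) n (Nat.lt_succ_self n)]

open Polynomial in
/-- If two sums of `p ^ (s + 1)`-th roots of unity with the same number of terms agree but have no
term in common, then the number of terms is divisible by `p`. -/
theorem dvd_card_of_sum_pow_eq_sum_pow {K ι : Type*} [Field K] [CharZero K] [Fintype ι]
    {p s : ℕ} (hp : p.Prime) {ζ : K} (hζ : IsPrimitiveRoot ζ (p ^ (s + 1))) {L R : ι → ℕ}
    (hL : ∀ i, L i < p ^ (s + 1)) (hR : ∀ i, R i < p ^ (s + 1))
    (hLR : ∀ i j, L i ≠ R j) (h : ∑ i, ζ ^ L i = ∑ i, ζ ^ R i) : p ∣ Fintype.card ι := by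
  classical
  set F : ℤ[X] := ∑ i, X ^ L i - ∑ i, X ^ R i with hFdef
  have hX : ∀ T : ι → ℕ, (∀ i, T i < p ^ (s + 1)) →
      (∑ i, X ^ T i : ℤ[X]).degree < (p ^ (s + 1) : ℕ) := by
    intro T hT
    refine (degree_sum_le _ _).trans_lt ((Finset.sup_lt_iff (WithBot.bot_lt_coe _)).2 ?_)
    intro i _
    rw [degree_X_pow]
    exact_mod_cast hT i
  have hdeg : F.degree < (p ^ (s + 1) : ℕ) :=
    (degree_sub_le _ _).trans_lt (max_lt (hX L hL) (hX R hR))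
  have hF : aeval ζ F = 0 := by simp [hFdef, h]
  have hcoeff : ∀ k, max (F.coeff k) 0 = ((Finset.univ.filter fun i => L i = k).card : ℤ) := by
    intro k
    have hc : F.coeff k = ((Finset.univ.filter fun i => L i = k).card : ℤ) -
        ((Finset.univ.filter fun i => R i = k).card : ℤ) := by
      simp [hFdef, finsetSum_coeff, coeff_X_pow, eq_comm]
    rw [hc]
    by_cases hk : ∃ i, L i = k
    · obtain ⟨i, rfl⟩ := hk
      have : (Finset.univ.filter fun j => R j = L i) = ∅ :=
        Finset.filter_eq_empty_iff.2 fun j _ => (hLR i j).symm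
      simp [this]
    · have : (Finset.univ.filter fun i => L i = k) = ∅ :=
        Finset.filter_eq_empty_iff.2 fun i _ hi => hk ⟨i, hi⟩
      simp [this]
  have hcard : (Fintype.card ι : ℤ) = ∑ k ∈ Finset.range (p * p ^ s), max (F.coeff k) 0 := by
    simp_rw [hcoeff]
    rw [← Nat.cast_sum, ← Finset.card_univ, Finset.card_eq_sum_card_fiberwise (f := L)
      (t := Finset.range (p * p ^ s))]
    intro i _
    simpa [pow_succ'] using hL i
  rw [sum_range_mul_of_periodic fun k hk j hj => by
    rw [coeff_add_mul_eq_of_aeval_eq_zero hp hζ hdeg hF hk hj], nsmul_eq_mul] at hcard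
  exact Int.natCast_dvd_natCast.1 ⟨_, hcard⟩

theorem IsPrimitiveRoot.zpow_eq_zpow_iff_modEq {K : Type*} [Field K] {ζ : K} {m : ℕ}
    (hζ : IsPrimitiveRoot ζ m) (hm : m ≠ 0) {a b : ℤ} :
    ζ ^ a = ζ ^ b ↔ a ≡ b [ZMOD m] := by
  have h0 : ζ ≠ 0 := hζ.ne_zero hm
  rw [Int.modEq_comm, Int.modEq_iff_dvd, ← hζ.zpow_eq_one_iff_dvd, zpow_sub₀ h0,
    div_eq_one_iff_eq (zpow_ne_zero _ h0)]

/-- If two sums of `p`-power roots of unity agree and their common number of terms is prime to `p`,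
then they have a term in common. -/
theorem exists_modEq_of_sum_zpow_eq_sum_zpow {K ι : Type*} [Field K] [CharZero K] [Fintype ι]
    {p s : ℕ} (hp : p.Prime) {ζ : K} (hζ : IsPrimitiveRoot ζ (p ^ (s + 1)))
    (hι : ¬ p ∣ Fintype.card ι) {L R : ι → ℤ} (h : ∑ i, ζ ^ L i = ∑ i, ζ ^ R i) :
    ∃ i j, L i ≡ R j [ZMOD (p ^ (s + 1) : ℕ)] := by
  by_contra! hne
  have hm : p ^ (s + 1) ≠ 0 := pow_ne_zero _ hp.ne_zero
  have hm' : (0 : ℤ) < (p ^ (s + 1) : ℕ) := by exact_mod_cast Nat.pos_of_ne_zero hm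
  have hnn : ∀ x : ℤ, (((x % (p ^ (s + 1) : ℕ)).toNat : ℕ) : ℤ) = x % (p ^ (s + 1) : ℕ) :=
    fun x => Int.toNat_of_nonneg (Int.emod_nonneg _ hm'.ne')
  have hlt : ∀ x : ℤ, (x % (p ^ (s + 1) : ℕ)).toNat < p ^ (s + 1) := fun x => by
    have := Int.emod_lt_of_pos x hm'
    rw [← hnn] at this
    exact_mod_cast this
  have hpow : ∀ x : ℤ, ζ ^ (x % (p ^ (s + 1) : ℕ)).toNat = ζ ^ x := fun x => by
    rw [← zpow_natCast, hnn, hζ.zpow_eq_zpow_iff_modEq hm]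
    exact Int.mod_modEq _ _
  refine hι (dvd_card_of_sum_pow_eq_sum_pow hp hζ (fun i => hlt (L i)) (fun i => hlt (R i))
    (fun i j hij => hne i j ?_) (by simpa only [hpow] using h))
  have := congrArg (Nat.cast : ℕ → ℤ) hij
  rwa [hnn, hnn] at this

theorem eq_of_add_mul_mul_add_one_eq {K : Type*} [Field K] {x y w : K} (hx : x ^ 2 ≠ 1)
    (h : (x + y) * (x * w + 1) = (x + w) * (x * y + 1)) : y = w := by
  have : (x ^ 2 - 1) * (y - w) = 0 := by linear_combination -h
  exact sub_eq_zero.1 ((mul_eq_zero.1 this).resolve_left (sub_ne_zero.2 hx))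

theorem mul_eq_one_of_add_mul_mul_add_one_eq {K : Type*} [Field K] {x y z w : K} (hx : x ^ 2 ≠ 1)
    (hxz : x * z = 1) (h : (x + y) * (z * w + 1) = (z + w) * (x * y + 1)) : y * w = 1 := by
  have : (x ^ 2 - 1) * (y * w - 1) = 0 := by
    linear_combination -x * h + (x * w + y * w - x * y - 1) * hxz
  exact sub_eq_zero.1 ((mul_eq_zero.1 this).resolve_left (sub_ne_zero.2 hx))

theorem stmt_4 (p t : ℕ) (hp : p.Prime) (hodd : Odd p) (ht : 1 ≤ t)
    (m : ℕ) (hm : m = p ^ t)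
    (ζ : ℂ) (hζ : ζ = Complex.exp (2 * Real.pi * Complex.I / m))
    (a b c d : ℤ)
    (ha : ¬ a ≡ 0 [ZMOD (m : ℤ)]) (hb : ¬ b ≡ 0 [ZMOD (m : ℤ)])
    (hc : ¬ c ≡ 0 [ZMOD (m : ℤ)]) (hd : ¬ d ≡ 0 [ZMOD (m : ℤ)])
    (h : ((ζ ^ a + 1) / (ζ ^ a - 1)) * ((ζ ^ b + 1) / (ζ ^ b - 1)) =
         ((ζ ^ c + 1) / (ζ ^ c - 1)) * ((ζ ^ d + 1) / (ζ ^ d - 1))) :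
    (c ≡ a [ZMOD (m : ℤ)] ∧ d ≡ b [ZMOD (m : ℤ)]) ∨
    (c ≡ b [ZMOD (m : ℤ)] ∧ d ≡ a [ZMOD (m : ℤ)]) ∨
    (c ≡ -a [ZMOD (m : ℤ)] ∧ d ≡ -b [ZMOD (m : ℤ)]) ∨
    (c ≡ -b [ZMOD (m : ℤ)] ∧ d ≡ -a [ZMOD (m : ℤ)]) := by
  obtain ⟨s, rfl⟩ : ∃ s, t = s + 1 := ⟨t - 1, by lia⟩
  subst hm
  have hm0 : p ^ (s + 1) ≠ 0 := pow_ne_zero _ hp.ne_zero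
  have hprim : IsPrimitiveRoot ζ (p ^ (s + 1)) := hζ ▸ Complex.isPrimitiveRoot_exp _ hm0
  have hζ0 : ζ ≠ 0 := hprim.ne_zero hm0
  have hmod {u v : ℤ} : ζ ^ u = ζ ^ v ↔ u ≡ v [ZMOD (p ^ (s + 1) : ℕ)] :=
    hprim.zpow_eq_zpow_iff_modEq hm0
  have hne {u : ℤ} (hu : ¬ u ≡ 0 [ZMOD (p ^ (s + 1) : ℕ)]) : ζ ^ u - 1 ≠ 0 := by
    rw [← hmod, zpow_zero] at hu
    exact sub_ne_zero.2 hu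
  have hsq {u : ℤ} (hu : ¬ u ≡ 0 [ZMOD (p ^ (s + 1) : ℕ)]) : (ζ ^ u) ^ 2 ≠ 1 := by
    intro h1
    apply hu
    rw [← zpow_natCast, ← zpow_mul, hprim.zpow_eq_one_iff_dvd] at h1
    refine Int.modEq_zero_iff_dvd.2 (IsCoprime.dvd_of_dvd_mul_right ?_ h1)
    exact Nat.isCoprime_iff_coprime.2 (Nat.coprime_two_right.2 hodd.pow)
  have hrel : (ζ ^ a + ζ ^ b) * (ζ ^ c * ζ ^ d + 1) = (ζ ^ c + ζ ^ d) * (ζ ^ a * ζ ^ b + 1) := by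
    rw [div_mul_div_comm, div_mul_div_comm, div_eq_div_iff (mul_ne_zero (hne ha) (hne hb))
      (mul_ne_zero (hne hc) (hne hd))] at h
    linear_combination h / 2
  have same {u v z w : ℤ} (hu : ¬ u ≡ 0 [ZMOD (p ^ (s + 1) : ℕ)])
      (hr : (ζ ^ u + ζ ^ v) * (ζ ^ z * ζ ^ w + 1) = (ζ ^ z + ζ ^ w) * (ζ ^ u * ζ ^ v + 1))
      (huz : z ≡ u [ZMOD (p ^ (s + 1) : ℕ)]) : w ≡ v [ZMOD (p ^ (s + 1) : ℕ)] := by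
    rw [hmod.2 huz] at hr
    exact hmod.1 (eq_of_add_mul_mul_add_one_eq (hsq hu) hr).symm
  have opposite {u v z w : ℤ} (hu : ¬ u ≡ 0 [ZMOD (p ^ (s + 1) : ℕ)])
      (hr : (ζ ^ u + ζ ^ v) * (ζ ^ z * ζ ^ w + 1) = (ζ ^ z + ζ ^ w) * (ζ ^ u * ζ ^ v + 1))
      (huz : z ≡ -u [ZMOD (p ^ (s + 1) : ℕ)]) : w ≡ -v [ZMOD (p ^ (s + 1) : ℕ)] := by
    have hxz : ζ ^ u * ζ ^ z = 1 := by
      rw [hmod.2 huz, zpow_neg, mul_inv_cancel₀ (zpow_ne_zero _ hζ0)]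
    rw [← hmod, zpow_neg]
    exact eq_inv_of_mul_eq_one_right (mul_eq_one_of_add_mul_mul_add_one_eq (hsq hu) hxz hr)
  have hac : c ≡ a [ZMOD (p ^ (s + 1) : ℕ)] → d ≡ b [ZMOD (p ^ (s + 1) : ℕ)] := same ha hrel
  have had : d ≡ a [ZMOD (p ^ (s + 1) : ℕ)] → c ≡ b [ZMOD (p ^ (s + 1) : ℕ)] :=
    same ha (by linear_combination hrel)
  have hbc : c ≡ b [ZMOD (p ^ (s + 1) : ℕ)] → d ≡ a [ZMOD (p ^ (s + 1) : ℕ)] :=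
    same hb (by linear_combination hrel)
  have hbd : d ≡ b [ZMOD (p ^ (s + 1) : ℕ)] → c ≡ a [ZMOD (p ^ (s + 1) : ℕ)] :=
    same hb (by linear_combination hrel)
  have hac' : c ≡ -a [ZMOD (p ^ (s + 1) : ℕ)] → d ≡ -b [ZMOD (p ^ (s + 1) : ℕ)] :=
    opposite ha hrel
  have had' : d ≡ -a [ZMOD (p ^ (s + 1) : ℕ)] → c ≡ -b [ZMOD (p ^ (s + 1) : ℕ)] :=
    opposite ha (by linear_combination hrel)
  have hbc' : c ≡ -b [ZMOD (p ^ (s + 1) : ℕ)] → d ≡ -a [ZMOD (p ^ (s + 1) : ℕ)] :=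
    opposite hb (by linear_combination hrel)
  have hbd' : d ≡ -b [ZMOD (p ^ (s + 1) : ℕ)] → c ≡ -a [ZMOD (p ^ (s + 1) : ℕ)] :=
    opposite hb (by linear_combination hrel)
  suffices hcases : c ≡ a [ZMOD (p ^ (s + 1) : ℕ)] ∨ d ≡ a [ZMOD (p ^ (s + 1) : ℕ)] ∨
      c ≡ b [ZMOD (p ^ (s + 1) : ℕ)] ∨ d ≡ b [ZMOD (p ^ (s + 1) : ℕ)] ∨
      c ≡ -a [ZMOD (p ^ (s + 1) : ℕ)] ∨ d ≡ -a [ZMOD (p ^ (s + 1) : ℕ)] ∨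
      c ≡ -b [ZMOD (p ^ (s + 1) : ℕ)] ∨ d ≡ -b [ZMOD (p ^ (s + 1) : ℕ)] by
    rcases hcases with h | h | h | h | h | h | h | h
    · exact Or.inl ⟨h, hac h⟩
    · exact Or.inr (Or.inl ⟨had h, h⟩)
    · exact Or.inr (Or.inl ⟨h, hbc h⟩)
    · exact Or.inl ⟨hbd h, h⟩
    · exact Or.inr (Or.inr (Or.inl ⟨h, hac' h⟩))
    · exact Or.inr (Or.inr (Or.inr ⟨had' h, h⟩))
    · exact Or.inr (Or.inr (Or.inr ⟨h, hbc' h⟩))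
    · exact Or.inr (Or.inr (Or.inl ⟨hbd' h, h⟩))
  have hcard : ¬ p ∣ Fintype.card (Fin 4) := by
    rw [Fintype.card_fin]
    intro h4
    have h2 : p ∣ 2 := hp.dvd_of_dvd_pow (n := 2) h4
    rw [(Nat.prime_dvd_prime_iff_eq hp Nat.prime_two).1 h2] at hodd
    exact absurd hodd (by decide)
  obtain ⟨i, j, hij⟩ := exists_modEq_of_sum_zpow_eq_sum_zpow hp hprim hcard
    (L := ![a + c + d, b + c + d, a, b]) (R := ![a + b + c, a + b + d, c, d]) (by
      simp [Fin.sum_univ_four, zpow_add₀ hζ0]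
      linear_combination hrel)
  clear hac had hbc hbd hac' had' hbc' hbd'
  simp only [Int.modEq_iff_dvd] at hij ⊢
  generalize ((p ^ (s + 1) : ℕ) : ℤ) = m at hij ⊢
  have close {x y : ℤ} (hx : m ∣ x) (hxy : x = y ∨ x = -y) : m ∣ y := by
    rcases hxy with rfl | rfl
    · exact hx
    · exact dvd_neg.1 hx
  fin_cases i <;> fin_cases j <;>
    simp only [Fin.reduceFinMk, Fin.zero_eta, Fin.mk_one, Matrix.cons_val, Matrix.cons_val_zero,
      Matrix.cons_val_one] at hij
  · exact Or.inr <| Or.inr <| Or.inr <| Or.inl <| close hij (by lia)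
  · exact Or.inr <| Or.inr <| Or.inl <| close hij (by lia)
  · exact Or.inr <| Or.inr <| Or.inr <| Or.inr <| Or.inr <| Or.inl <| close hij (by lia)
  · exact Or.inr <| Or.inr <| Or.inr <| Or.inr <| Or.inl <| close hij (by lia)
  · exact Or.inr <| Or.inl <| close hij (by lia)
  · exact Or.inl <| close hij (by lia)
  · exact Or.inr <| Or.inr <| Or.inr <| Or.inr <| Or.inr <| Or.inr <| Or.inr <| close hij (by lia)
  · exact Or.inr <| Or.inr <| Or.inr <| Or.inr <| Or.inr <| Or.inr <| Or.inl <| close hij (by lia)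
  · exact Or.inr <| Or.inr <| Or.inr <| Or.inr <| Or.inr <| Or.inr <| Or.inl <| close hij (by lia)
  · exact Or.inr <| Or.inr <| Or.inr <| Or.inr <| Or.inr <| Or.inr <| Or.inr <| close hij (by lia)
  · exact Or.inl <| close hij (by lia)
  · exact Or.inr <| Or.inl <| close hij (by lia)
  · exact Or.inr <| Or.inr <| Or.inr <| Or.inr <| Or.inl <| close hij (by lia)
  · exact Or.inr <| Or.inr <| Or.inr <| Or.inr <| Or.inr <| Or.inl <| close hij (by lia)
  · exact Or.inr <| Or.inr <| Or.inl <| close hij (by lia)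
  · exact Or.inr <| Or.inr <| Or.inr <| Or.inl <| close hij (by lia)
end

section
/- Let p be an odd prime, t ≥ 1, m = p^t, and ζ = exp(2πi/m) ∈ ℂ. Suppose a, b, c, d are integers, none congruent to 0 mod m, such that ((ζ^a + 1)/(ζ^a − 1)) · ((ζ^b + 1)/(ζ^b − 1)) + ((ζ^c + 1)/(ζ^c − 1)) · ((ζ^d + 1)/(ζ^d − 1)) = 0. Then the unordered pair {c, d} is congruent mod m to {−a, b} or to {a, −b}; that is, (c ≡ −a and d ≡ b) or (c ≡ b and d ≡ −a) or (c ≡ a and d ≡ −b) or (c ≡ −b and d ≡ a), all congruences taken mod m. -/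
open Polynomial in
theorem pow_mul_aeval_eq_self_of_isPrimitiveRoot {p k : ℕ} (hp : p.Prime) {ζ : ℂ}
    (hζ : IsPrimitiveRoot ζ (p ^ (k + 1))) {F : ℤ[X]} (hF : aeval ζ F = 0)
    {R : Type*} [CommRing R] [Algebra ℤ R] {T : R} (hT : T ^ p ^ (k + 1) = 1) :
    T ^ p ^ k * aeval T F = aeval T F := by
  have hpos : 0 < p ^ (k + 1) := pow_pos hp.pos _
  obtain ⟨Q, rfl⟩ : cyclotomic (p ^ (k + 1)) ℤ ∣ F := by
    rw [cyclotomic_eq_minpoly hζ hpos]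
    exact minpoly.isIntegrallyClosed_dvd (hζ.isIntegral hpos) hF
  have := Fact.mk hp
  have := congrArg (aeval T) (cyclotomic_prime_pow_mul_X_pow_sub_one ℤ p k)
  simp only [map_mul, map_sub, map_pow, aeval_X, map_one, hT, sub_self] at this ⊢
  linear_combination (aeval T Q) * this

/-- The coefficient at `x` of `(1 + T ^ (a + b)) (1 + T ^ (c + d)) - (T ^ a + T ^ b) (T ^ c + T ^ d)`
in the group ring `ℤ[G]`. -/
def relationCoeff {G : Type*} [AddCommGroup G] [DecidableEq G] (a b c d x : G) : ℤ :=
  ((if 0 = x then 1 else 0) + (if a + b = x then 1 else 0)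
    + (if c + d = x then 1 else 0) + (if a + b + (c + d) = x then 1 else 0))
  - ((if a + c = x then 1 else 0) + (if a + d = x then 1 else 0)
    + (if b + c = x then 1 else 0) + (if b + d = x then 1 else 0))

theorem relationCoeff_swap_left {G : Type*} [AddCommGroup G] [DecidableEq G] (a b c d x : G) :
    relationCoeff b a c d x = relationCoeff a b c d x := by
  simp only [relationCoeff, add_comm b a]
  ring

theorem relationCoeff_swap_right {G : Type*} [AddCommGroup G] [DecidableEq G] (a b c d x : G) :
    relationCoeff a b d c x = relationCoeff a b c d x := by
  simp only [relationCoeff, add_comm d c]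
  ring

theorem relationCoeff_periodic {p k : ℕ} (hp : p.Prime) {ζ : ℂ}
    (hζ : IsPrimitiveRoot ζ (p ^ (k + 1))) (a b c d : ℕ)
    (h : (1 + ζ ^ (a + b)) * (1 + ζ ^ (c + d)) = (ζ ^ a + ζ ^ b) * (ζ ^ c + ζ ^ d))
    (x : ZMod (p ^ (k + 1))) :
    relationCoeff (a : ZMod (p ^ (k + 1))) b c d (x + (p ^ k : ℕ))
      = relationCoeff (a : ZMod (p ^ (k + 1))) b c d x := by
  let T : AddMonoidAlgebra ℤ (ZMod (p ^ (k + 1))) := AddMonoidAlgebra.single 1 1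
  have hpow (n : ℕ) : T ^ n = AddMonoidAlgebra.single (n : ZMod (p ^ (k + 1))) 1 := by
    simp [T, AddMonoidAlgebra.single_pow]
  have hT : T ^ p ^ (k + 1) = 1 := by
    rw [hpow, ZMod.natCast_self, AddMonoidAlgebra.one_def]
  have key := pow_mul_aeval_eq_self_of_isPrimitiveRoot hp hζ (T := T)
    (F := 1 + .X ^ (a + b) + .X ^ (c + d) + .X ^ (a + b + (c + d))
      - (.X ^ (a + c) + .X ^ (a + d) + .X ^ (b + c) + .X ^ (b + d)))
    (by simp; linear_combination h) hT
  have hcoeff (y : ZMod (p ^ (k + 1))) : (Polynomial.aeval T (1 + .X ^ (a + b) + .X ^ (c + d)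
      + .X ^ (a + b + (c + d)) - (.X ^ (a + c) + .X ^ (a + d) + .X ^ (b + c) + .X ^ (b + d))
      : Polynomial ℤ)).coeff y
      = relationCoeff (a : ZMod (p ^ (k + 1))) b c d y := by
    simp only [map_add, map_sub, map_pow, map_one, Polynomial.aeval_X, hpow, relationCoeff,
      AddMonoidAlgebra.one_def]
    simp [Finsupp.single_apply]
  have hshift := congrArg (fun g ↦ g.coeff (((p ^ k : ℕ) : ZMod (p ^ (k + 1))) + x)) key
  simp only [hpow (p ^ k), AddMonoidAlgebra.coeff_single_mul_add, hcoeff, one_mul] at hshift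
  rw [hshift, add_comm x]

theorem eq_neg_and_eq_of_add_eq_zero {G : Type*} [AddCommGroup G] [DecidableEq G]
    {a b c d ω : G} (ha : a + a ≠ 0) (hω : ω ≠ 0) (hω₂ : ω + ω ≠ 0)
    (h : ∀ x, relationCoeff a b c d (x + ω) = relationCoeff a b c d x)
    (hac : a + c = 0) : c = -a ∧ d = b := by
  set f := relationCoeff a b c d with f_def
  have hf := fun x ↦ congrFun f_def x
  simp only [relationCoeff] at hf
  clear_value f
  clear f_def
  obtain rfl : c = -a := eq_neg_of_add_eq_zero_right hac
  refine ⟨rfl, ?_⟩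
  by_contra hdb
  have hf' (x : G) : f x = ((if a + b = x then 1 else 0) + (if d - a = x then 1 else 0))
      - ((if a + d = x then 1 else 0) + (if b - a = x then 1 else 0)) := by
    rw [hf, show -a + d = d - a by abel, show a + b + (d - a) = b + d by abel,
      show a + -a = 0 by abel, show b + -a = b - a by abel]
    ring
  have hpos (x : G) (hx : 0 < f x) : a + b = x ∨ d - a = x := by
    rw [hf'] at hx
    by_contra! hne
    rw [if_neg hne.1, if_neg hne.2] at hx
    split_ifs at hx <;> simp at hx
  have h₀ : 0 < f (a + b) := by
    have h₁ : a + d ≠ a + b := by simpa using hdb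
    have h₂ : b - a ≠ a + b := fun h' ↦ ha (by
      calc a + a = a + b - (b - a) := by abel
        _ = 0 := by rw [h', sub_self])
    rw [hf', if_neg h₁, if_neg h₂]
    split_ifs <;> simp_all
  have h₁ := hpos (a + b + ω) (by rwa [h])
  have h₂ := hpos (a + b + ω + ω) (by rwa [h, h])
  grind

theorem sum_indicator_add_eq_even {R : Type*} [CommRing R] [DecidableEq R] {a b c d y : R}
    (h : a + b + (c + d) = y + y) :
    ∃ r : ℤ, (if a + c = y then 1 else 0) + (if a + d = y then 1 else 0)
      + (if b + c = y then 1 else 0) + (if b + d = y then 1 else 0) = 2 * r := by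
  have h₁ : a + c = y ↔ b + d = y :=
    ⟨fun h' ↦ by linear_combination h - h', fun h' ↦ by linear_combination h - h'⟩
  have h₂ : a + d = y ↔ b + c = y :=
    ⟨fun h' ↦ by linear_combination h - h', fun h' ↦ by linear_combination h - h'⟩
  refine ⟨(if b + d = y then 1 else 0) + (if b + c = y then 1 else 0), ?_⟩
  simp only [h₁, h₂]
  ring

theorem sum_indicator_add_eq_nonneg {R : Type*} [CommRing R] [DecidableEq R] (a b c d y : R) :
    (0 : ℤ) ≤ (if a + c = y then 1 else 0) + (if a + d = y then 1 else 0)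
      + (if b + c = y then 1 else 0) + (if b + d = y then 1 else 0) := by
  positivity

theorem add_eq_zero_of_relationCoeff_periodic {R : Type*} [CommRing R] [DecidableEq R]
    {a b c d ω : R} (hω : ω ≠ 0) (hω₂ : ω + ω ≠ 0) (hω₄ : ω + ω + ω + ω ≠ 0)
    (h : ∀ x, relationCoeff a b c d (x + ω) = relationCoeff a b c d x) :
    a + c = 0 ∨ a + d = 0 ∨ b + c = 0 ∨ b + d = 0 := by
  set f := relationCoeff a b c d with f_def
  have hf := fun x ↦ congrFun f_def x
  simp only [relationCoeff] at hf
  clear_value f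
  clear f_def
  by_contra! hne
  obtain ⟨n₁, n₂, n₃, n₄⟩ := hne
  have hpos (x : R) (hx : 0 < f x) : 0 = x ∨ a + b = x ∨ c + d = x ∨ a + b + (c + d) = x := by
    rw [hf] at hx
    by_contra! hne
    rw [if_neg hne.1, if_neg hne.2.1, if_neg hne.2.2.1, if_neg hne.2.2.2] at hx
    split_ifs at hx <;> simp at hx
  have e₁ : f ω = f 0 := by simpa using h 0
  have e₂ : f (ω + ω) = f 0 := by rw [h, e₁]
  have e₃ : f (ω + ω + ω) = f 0 := by rw [h, e₂]
  have e₄ : f (ω + ω + ω + ω) = f 0 := by rw [h, e₃]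
  have h₀ : 0 < f 0 := by
    rw [hf, if_neg n₁, if_neg n₂, if_neg n₃, if_neg n₄, if_pos rfl]
    clear * -
    split_ifs <;> norm_num
  have m₁ := hpos _ (e₁ ▸ h₀)
  have m₂ := hpos _ (e₂ ▸ h₀)
  have m₃ := hpos _ (e₃ ▸ h₀)
  have m₄ := hpos _ (e₄ ▸ h₀)
  by_cases hω₃ : ω + ω + ω = 0
  · have q₀ := hf 0
    have q₁ := hf ω
    have q₂ := hf (ω + ω)
    rw [if_neg n₁, if_neg n₂, if_neg n₃, if_neg n₄] at q₀
    have p₁ := sum_indicator_add_eq_nonneg a b c d ω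
    have p₂ := sum_indicator_add_eq_nonneg a b c d (ω + ω)
    have r₁ := sum_indicator_add_eq_even (a := a) (b := b) (c := c) (d := d) (y := ω)
    have r₂ (hs : a + b + (c + d) = ω) :=
      sum_indicator_add_eq_even (a := a) (b := b) (c := c) (d := d) (y := ω + ω)
        (by linear_combination hs - hω₃)
    rw [q₀] at e₁ e₂
    rw [e₁] at q₁
    rw [e₂] at q₂
    clear h hpos hf m₃ m₄ e₁ e₂ e₃ e₄ h₀ n₁ n₂ n₃ n₄ hω₄ q₀
    generalize (if a + c = ω then (1 : ℤ) else 0) + (if a + d = ω then 1 else 0)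
      + (if b + c = ω then 1 else 0) + (if b + d = ω then 1 else 0) = A at *
    generalize (if a + c = ω + ω then (1 : ℤ) else 0) + (if a + d = ω + ω then 1 else 0)
      + (if b + c = ω + ω then 1 else 0) + (if b + d = ω + ω then 1 else 0) = B at *
    generalize a + b = u at *
    generalize c + d = v at *
    have s₁ (h₁ : u + v = ω) (h₂ : v = ω + ω) : u = ω + ω := by
      linear_combination h₁ - h₂ - hω₃
    have s₂ (h₁ : u + v = ω) (h₂ : u = ω + ω) : v = ω + ω := by
      linear_combination h₁ - h₂ - hω₃
    rcases m₁ with m₁ | m₁ | m₁ | m₁ <;> rcases m₂ with m₂ | m₂ | m₂ | m₂ <;> grind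
  · clear hf h hpos e₁ e₂ e₃ e₄ h₀
    grind

theorem stmt_5 (p t : ℕ) (hp : p.Prime) (hodd : Odd p) (ht : 1 ≤ t)
    (m : ℕ) (hm : m = p ^ t)
    (ζ : ℂ) (hζ : ζ = Complex.exp (2 * Real.pi * Complex.I / m))
    (a b c d : ℤ)
    (ha : ¬ a ≡ 0 [ZMOD (m : ℤ)]) (hb : ¬ b ≡ 0 [ZMOD (m : ℤ)])
    (hc : ¬ c ≡ 0 [ZMOD (m : ℤ)]) (hd : ¬ d ≡ 0 [ZMOD (m : ℤ)])
    (h : ((ζ ^ a + 1) / (ζ ^ a - 1)) * ((ζ ^ b + 1) / (ζ ^ b - 1)) +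
         ((ζ ^ c + 1) / (ζ ^ c - 1)) * ((ζ ^ d + 1) / (ζ ^ d - 1)) = 0) :
    (c ≡ -a [ZMOD (m : ℤ)] ∧ d ≡ b [ZMOD (m : ℤ)]) ∨
    (c ≡ b [ZMOD (m : ℤ)] ∧ d ≡ -a [ZMOD (m : ℤ)]) ∨
    (c ≡ a [ZMOD (m : ℤ)] ∧ d ≡ -b [ZMOD (m : ℤ)]) ∨
    (c ≡ -b [ZMOD (m : ℤ)] ∧ d ≡ a [ZMOD (m : ℤ)]) := by
  obtain ⟨k, rfl⟩ : ∃ k, t = k + 1 := ⟨t - 1, by omega⟩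
  subst hm
  have hm0 : p ^ (k + 1) ≠ 0 := pow_ne_zero _ hp.ne_zero
  have hprim : IsPrimitiveRoot ζ (p ^ (k + 1)) := hζ ▸ Complex.isPrimitiveRoot_exp _ hm0
  have hmZ : ((p ^ (k + 1) : ℕ) : ℤ) ≠ 0 := by exact_mod_cast hm0
  have hrep (z : ℤ) : ∃ n : ℕ, z ≡ n [ZMOD (p ^ (k + 1) : ℕ)] ∧ ζ ^ z = ζ ^ n := by
    refine ⟨(z % (p ^ (k + 1) : ℕ)).toNat, ?_⟩
    have hn : ((z % (p ^ (k + 1) : ℕ)).toNat : ℤ) = z % (p ^ (k + 1) : ℕ) :=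
      Int.toNat_of_nonneg (Int.emod_nonneg _ hmZ)
    refine ⟨by rw [hn]; exact (Int.mod_modEq _ _).symm, ?_⟩
    rw [← zpow_natCast, hn]
    conv_lhs => rw [← Int.emod_add_mul_ediv z (p ^ (k + 1) : ℕ)]
    rw [zpow_add₀ (hprim.ne_zero hm0), zpow_mul, zpow_natCast ζ (p ^ (k + 1)), hprim.pow_eq_one,
      one_zpow, mul_one]
  have hsub (z : ℤ) (hz : ¬ z ≡ 0 [ZMOD (p ^ (k + 1) : ℕ)]) : ζ ^ z - 1 ≠ 0 := by
    rwa [sub_ne_zero, Ne, hprim.zpow_eq_one_iff_dvd, ← Int.modEq_zero_iff_dvd]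
  have key : (1 + ζ ^ a * ζ ^ b) * (1 + ζ ^ c * ζ ^ d)
      = (ζ ^ a + ζ ^ b) * (ζ ^ c + ζ ^ d) := by
    have := hsub a ha
    have := hsub b hb
    have := hsub c hc
    have := hsub d hd
    field_simp at h
    linear_combination h / 2
  obtain ⟨a', ea, za⟩ := hrep a
  obtain ⟨b', eb, zb⟩ := hrep b
  obtain ⟨c', ec, zc⟩ := hrep c
  obtain ⟨d', ed, zd⟩ := hrep d
  rw [za, zb, zc, zd, ← pow_add, ← pow_add] at key
  have hper := relationCoeff_periodic hp hprim a' b' c' d' key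
  have hcop : IsCoprime (2 : ℤ) ((p ^ (k + 1) : ℕ) : ℤ) := by
    rw [Nat.cast_pow]
    exact ((Nat.isCoprime_iff_coprime (m := 2)).2 hodd.coprime_two_left).pow_right
  have htwo (x : ZMod (p ^ (k + 1))) (hx : x ≠ 0) : x + x ≠ 0 := by
    rw [← two_mul]
    obtain ⟨u, v, huv⟩ := hcop
    intro h0
    have huv' := congrArg (Int.cast : ℤ → ZMod (p ^ (k + 1))) huv
    push_cast at huv'
    have hz : ((p : ZMod (p ^ (k + 1))) ^ (k + 1)) = 0 := by exact_mod_cast ZMod.natCast_self _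
    apply hx
    linear_combination (u : ZMod (p ^ (k + 1))) * h0 - x * huv' + x * v * hz
  have hω : ((p ^ k : ℕ) : ZMod (p ^ (k + 1))) ≠ 0 := by
    rw [Ne, ZMod.natCast_eq_zero_iff, Nat.pow_dvd_pow_iff_le_right hp.one_lt]
    omega
  have hω₂ := htwo _ hω
  have hω₄ := htwo _ hω₂
  rw [← add_assoc] at hω₄
  simp only [← ZMod.intCast_eq_intCast_iff, Int.cast_neg, Int.cast_natCast, Int.cast_zero]
    at ha hb ea eb ec ed ⊢
  rw [ea] at ha
  rw [eb] at hb
  rw [ea, eb, ec, ed]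
  have ha₂ := htwo _ ha
  have hb₂ := htwo _ hb
  rcases add_eq_zero_of_relationCoeff_periodic hω hω₂ hω₄ hper with h₀ | h₀ | h₀ | h₀
  · exact Or.inl (eq_neg_and_eq_of_add_eq_zero ha₂ hω hω₂ hper h₀)
  · have hper' := fun x ↦ (relationCoeff_swap_right ..).trans
      ((hper x).trans (relationCoeff_swap_right ..).symm)
    have hdc := eq_neg_and_eq_of_add_eq_zero ha₂ hω hω₂ hper' h₀
    exact Or.inr (Or.inl hdc.symm)
  · have hper' := fun x ↦ (relationCoeff_swap_left ..).trans
      ((hper x).trans (relationCoeff_swap_left ..).symm)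
    have hcd := eq_neg_and_eq_of_add_eq_zero hb₂ hω hω₂ hper' h₀
    exact Or.inr (Or.inr (Or.inr hcd))
  · have hper' := fun x ↦ ((relationCoeff_swap_left ..).trans (relationCoeff_swap_right ..)).trans
      ((hper x).trans ((relationCoeff_swap_left ..).trans (relationCoeff_swap_right ..)).symm)
    have hdc := eq_neg_and_eq_of_add_eq_zero hb₂ hω hω₂ hper' h₀
    exact Or.inr (Or.inr (Or.inl hdc.symm))
end

section
/- Let p be an odd prime, t ≥ 1, m = p^t, and ζ = exp(2πi/m) ∈ ℂ. Let k be an integer and let c, d be integers not divisible by p. If (−4kζ)/(ζ − 1)^2 + p · ((ζ^c + 1)/(ζ^c − 1)) · ((ζ^d + 1)/(ζ^d − 1)) = p, then p divides k. -/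
theorem IsPrimitiveRoot.isIntegral_sub_one_mul_add_one_div_sub_one {K : Type*} [Field K]
    {ζ η : K} {m : ℕ} (hζ : IsPrimitiveRoot ζ m) (hη : IsPrimitiveRoot η m) (hm : 1 < m) :
    IsIntegral ℤ ((ζ - 1) * ((η + 1) / (η - 1))) := by
  have : NeZero m := ⟨by lia⟩
  obtain ⟨i, -, rfl⟩ := hη.eq_pow_of_pow_eq_one hζ.pow_eq_one
  have hη₁ : η - 1 ≠ 0 := sub_ne_zero.mpr (hη.ne_one hm)
  have h_int : IsIntegral ℤ η := hη.isIntegral (by lia)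
  have key : (η ^ i - 1) * ((η + 1) / (η - 1)) = (∑ j ∈ Finset.range i, η ^ j) * (η + 1) := by
    rw [← geom_sum_mul]
    field_simp
  rw [key]
  exact (IsIntegral.sum _ fun j _ => h_int.pow j).mul (h_int.add isIntegral_one)

theorem Int.dvd_of_isIntegral_div {K : Type*} [Field K] [CharZero K] {a b : ℤ} (hb : b ≠ 0)
    (h : IsIntegral ℤ ((a : K) / b)) : b ∣ a := by
  have h' : IsIntegral ℤ (algebraMap ℚ K ((a : ℚ) / b)) := by simpa using h
  rw [isIntegral_algebraMap_iff (algebraMap ℚ K).injective] at h'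
  obtain ⟨y, hy⟩ := IsIntegrallyClosed.isIntegral_iff.mp h'
  refine ⟨y, ?_⟩
  have hb' : (b : ℚ) ≠ 0 := by exact_mod_cast hb
  rw [eq_div_iff hb', eq_intCast] at hy
  rw [mul_comm]
  exact_mod_cast hy.symm

theorem stmt_7 (p t : ℕ) (hp : p.Prime) (hodd : Odd p) (ht : 1 ≤ t)
    (m : ℕ) (hm : m = p ^ t)
    (ζ : ℂ) (hζ : ζ = Complex.exp (2 * Real.pi * Complex.I / m))
    (k c d : ℤ) (hc : ¬ (p : ℤ) ∣ c) (hd : ¬ (p : ℤ) ∣ d)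
    (h : (-4 * (k : ℂ) * ζ) / (ζ - 1) ^ 2 +
         (p : ℂ) * ((ζ ^ c + 1) / (ζ ^ c - 1)) * ((ζ ^ d + 1) / (ζ ^ d - 1)) = (p : ℂ)) :
    (p : ℤ) ∣ k := by
  have hm₁ : 1 < m := hm ▸ Nat.one_lt_pow (by lia) hp.one_lt
  have hprim : IsPrimitiveRoot ζ m := hζ ▸ Complex.isPrimitiveRoot_exp m (by lia)
  have hpow : ∀ a : ℤ, ¬ (p : ℤ) ∣ a → IsPrimitiveRoot (ζ ^ a) m := fun a ha => by
    refine hprim.zpow_of_gcd_eq_one a (Int.isCoprime_iff_gcd_eq_one.mp ?_)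
    rw [hm, Nat.cast_pow]
    exact (((Nat.prime_iff_prime_int.mp hp).coprime_iff_not_dvd.mpr ha).symm).pow_right
  have hA := hprim.isIntegral_sub_one_mul_add_one_div_sub_one (hpow c hc) hm₁
  have hB := hprim.isIntegral_sub_one_mul_add_one_div_sub_one (hpow d hd) hm₁
  have h_int : IsIntegral ℤ ζ := hprim.isIntegral (by lia)
  have h_inv : IsIntegral ℤ ζ⁻¹ := hprim.inv.isIntegral (by lia)
  have hζ₀ : ζ ≠ 0 := hprim.ne_zero (by lia)
  have hζ₁ : ζ - 1 ≠ 0 := sub_ne_zero.mpr (hprim.ne_one hm₁)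
  have hp₀ : (p : ℂ) ≠ 0 := by exact_mod_cast hp.ne_zero
  generalize (ζ ^ c + 1) / (ζ ^ c - 1) = x at h hA
  generalize (ζ ^ d + 1) / (ζ ^ d - 1) = y at h hB
  have key : ((4 * k : ℤ) : ℂ) / (p : ℤ) =
      ((ζ - 1) * x * ((ζ - 1) * y) - (ζ - 1) ^ 2) * ζ⁻¹ := by
    push_cast
    field_simp at h ⊢
    linear_combination -h
  have hdvd : (p : ℤ) ∣ 4 * k := by
    refine Int.dvd_of_isIntegral_div (K := ℂ) (by exact_mod_cast hp.ne_zero) ?_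
    rw [key]
    exact ((hA.mul hB).sub ((h_int.sub isIntegral_one).pow 2)).mul h_inv
  refine ((Nat.prime_iff_prime_int.mp hp).dvd_or_dvd hdvd).resolve_left fun h₄ => ?_
  have h₂ : p ∣ 2 ^ 2 := by exact_mod_cast h₄
  rw [(Nat.prime_dvd_prime_iff_eq hp Nat.prime_two).mp (hp.dvd_of_dvd_pow h₂)] at hodd
  exact absurd hodd (by decide)
end

section
/- Let ζ = exp(2πi/9) ∈ ℂ, and let a₁, a₂, a₃, b₁, b₂, b₃ be integers, each not divisible by 3. If Σ_{i=1}^{3} ((ζ^{a_i} + 1)/(ζ^{a_i} − 1)) · ((ζ^{b_i} + 1)/(ζ^{b_i} − 1)) = 1, then Σ_{i=1}^{3} ((ζ^{3a_i} + 1)/(ζ^{3a_i} − 1)) · ((ζ^{3b_i} + 1)/(ζ^{3b_i} − 1)) = 1. -/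
open Polynomial in
/-- The elements `1`, `ζ - ζ² - ζ⁵`, `ζ⁴ + ζ⁵` of the ninth cyclotomic field are linearly independent
over `ℤ`. -/
theorem IsPrimitiveRoot.eq_zero_of_ninth_real_combination {ζ : ℂ} (hζ : IsPrimitiveRoot ζ 9)
    {p q r : ℤ} (h : (p : ℂ) + q * (ζ - ζ ^ 2 - ζ ^ 5) + r * (ζ ^ 4 + ζ ^ 5) = 0) :
    p = 0 ∧ q = 0 ∧ r = 0 := by
  set P : ℚ[X] := C (p : ℚ) + C (q : ℚ) * X - C (q : ℚ) * X ^ 2 + C (r : ℚ) * X ^ 4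
    + C ((r : ℚ) - q) * X ^ 5 with hP
  have haeval : aeval ζ P = 0 := by
    simp only [hP, map_add, map_sub, map_mul, map_pow, aeval_X, map_intCast]
    linear_combination h
  have hdeg : P.natDegree ≤ 5 := by
    rw [hP]
    compute_degree
  have hzero : P = 0 := by
    by_contra hne
    have hle := natDegree_le_natDegree (minpoly.degree_le_of_ne_zero ℚ ζ hne haeval)
    rw [← cyclotomic_eq_minpoly_rat hζ (by norm_num), natDegree_cyclotomic,
      show Nat.totient 9 = 6 by decide] at hle
    omega
  have hcoeff (n : ℕ) : P.coeff n = 0 := by rw [hzero, coeff_zero]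
  have h0 := hcoeff 0
  have h1 := hcoeff 1
  have h4 := hcoeff 4
  simp only [hP, coeff_add, coeff_sub, coeff_C_mul, coeff_X, coeff_C, coeff_X_pow] at h0 h1 h4
  norm_num at h0 h1 h4
  exact ⟨h0, h1, h4⟩

theorem IsPrimitiveRoot.ninth_root_relation {ζ : ℂ} (hζ : IsPrimitiveRoot ζ 9) :
    ζ ^ 6 + ζ ^ 3 + 1 = 0 := by
  have h3 : IsPrimitiveRoot (ζ ^ 3) 3 := hζ.pow (by norm_num) (by norm_num)
  have h := h3.geom_sum_eq_zero (by norm_num)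
  simp only [Finset.sum_range_succ, Finset.sum_range_zero] at h
  linear_combination h

/-- The Cayley transform `(z + 1) / (z - 1)`. -/
noncomputable def cayley (z : ℂ) : ℂ := (z + 1) / (z - 1)

theorem cayley_inv {z : ℂ} (hz : z ≠ 0) : cayley z⁻¹ = -cayley z := by
  unfold cayley
  by_cases h1 : z = 1
  · simp [h1]
  have h2 : z - 1 ≠ 0 := sub_ne_zero.mpr h1
  have h3 : 1 - z ≠ 0 := sub_ne_zero.mpr (Ne.symm h1)
  field_simp
  ring

/-- The Cayley transform at a primitive ninth root of unity, as a polynomial. -/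
theorem IsPrimitiveRoot.cayley_ninth {ζ : ℂ} (hζ : IsPrimitiveRoot ζ 9) :
    cayley ζ = -(1 + 4 * ζ + 4 * ζ ^ 2 + 2 * ζ ^ 3 + 2 * ζ ^ 4 + 2 * ζ ^ 5) / 3 := by
  have h1 : ζ - 1 ≠ 0 := sub_ne_zero.mpr (hζ.ne_one (by norm_num))
  rw [cayley, div_eq_iff h1]
  linear_combination (2 / 3 : ℂ) * hζ.ninth_root_relation

/-- The Cayley transform at a primitive cube root of unity, as a polynomial. -/
theorem IsPrimitiveRoot.cayley_cube {ω : ℂ} (hω : IsPrimitiveRoot ω 3) :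
    cayley ω = -(1 + 2 * ω) / 3 := by
  have h1 : ω - 1 ≠ 0 := sub_ne_zero.mpr (hω.ne_one (by norm_num))
  have h := hω.geom_sum_eq_zero (by norm_num)
  simp only [Finset.sum_range_succ, Finset.sum_range_zero] at h
  rw [cayley, div_eq_iff h1]
  linear_combination (2 / 3 : ℂ) * h

/-- Up to sign, every value of the Cayley transform at a primitive ninth root of unity is one of
three polynomials in `ζ`; the sign is the one relating the values at the cubes. -/
theorem IsPrimitiveRoot.exists_cayley_zpow_eq {ζ : ℂ} (hζ : IsPrimitiveRoot ζ 9) {a : ℤ}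
    (ha : ¬ (3 : ℤ) ∣ a) :
    ∃ e ∈ [(1 : ℤ), -1],
      (3 * cayley (ζ ^ a) = -e * (1 + 4 * ζ + 4 * ζ ^ 2 + 2 * ζ ^ 3 + 2 * ζ ^ 4 + 2 * ζ ^ 5) ∨
        3 * cayley (ζ ^ a) = -e * (1 - 2 * ζ - 2 * ζ ^ 2 + 2 * ζ ^ 3 + 2 * ζ ^ 4 - 4 * ζ ^ 5) ∨
        3 * cayley (ζ ^ a) = -e * (1 - 2 * ζ - 2 * ζ ^ 2 + 2 * ζ ^ 3 - 4 * ζ ^ 4 + 2 * ζ ^ 5)) ∧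
      3 * cayley (ζ ^ (3 * a)) = -e * (1 + 2 * ζ ^ 3) := by
  have key (b : ℤ) (hb : b % 3 = 1) :
      (3 * cayley (ζ ^ b) = -(1 + 4 * ζ + 4 * ζ ^ 2 + 2 * ζ ^ 3 + 2 * ζ ^ 4 + 2 * ζ ^ 5) ∨
        3 * cayley (ζ ^ b) = -(1 - 2 * ζ - 2 * ζ ^ 2 + 2 * ζ ^ 3 + 2 * ζ ^ 4 - 4 * ζ ^ 5) ∨
        3 * cayley (ζ ^ b) = -(1 - 2 * ζ - 2 * ζ ^ 2 + 2 * ζ ^ 3 - 4 * ζ ^ 4 + 2 * ζ ^ 5)) ∧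
      3 * cayley (ζ ^ (3 * b)) = -(1 + 2 * ζ ^ 3) := by
    have hrel := hζ.ninth_root_relation
    have hmod (m : ℤ) (n : ℕ) (hmn : (9 : ℤ) ∣ m - n) : ζ ^ m = ζ ^ n := by
      have h1 : ζ ^ (m - n) = 1 := (hζ.zpow_eq_one_iff_dvd _).mpr (by exact_mod_cast hmn)
      rw [← sub_add_cancel m (n : ℤ), zpow_add₀ (hζ.ne_zero (by norm_num)), h1, one_mul,
        zpow_natCast]
    constructor
    · have hcases : b % 9 = 1 ∨ b % 9 = 4 ∨ b % 9 = 7 := by omega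
      rcases hcases with h | h | h
      · left
        rw [hmod b 1 (by push_cast; omega), pow_one, hζ.cayley_ninth]
        ring
      · right; left
        rw [hmod b 4 (by push_cast; omega), (hζ.pow_of_coprime 4 (by norm_num)).cayley_ninth]
        grind
      · right; right
        rw [hmod b 7 (by push_cast; omega), (hζ.pow_of_coprime 7 (by norm_num)).cayley_ninth]
        grind
    · rw [hmod (3 * b) 3 (by push_cast; omega),
        (hζ.pow (by norm_num) (by norm_num : 9 = 3 * 3)).cayley_cube]
      ring
  have hcases : a % 3 = 1 ∨ (-a) % 3 = 1 := by omega
  rcases hcases with h | h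
  · exact ⟨1, by simp, by simpa using key a h⟩
  · refine ⟨-1, by simp, ?_⟩
    have hne (n : ℤ) : ζ ^ n ≠ 0 := zpow_ne_zero _ (hζ.ne_zero (by norm_num))
    have h' := key (-a) h
    rw [mul_neg, zpow_neg, zpow_neg, cayley_inv (hne _), cayley_inv (hne _)] at h'
    simpa [mul_neg, neg_eq_iff_eq_neg] using h'

/-- Coordinates, with respect to `1`, `ζ - ζ² - ζ⁵`, `ζ⁴ + ζ⁵`, of three times the products of
values of the Cayley transform at `ζ`, `ζ⁴`, `ζ⁷`. -/
def cayleyProductCoords : List (ℤ × ℤ × ℤ) :=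
  [(-9, -4, 4), (3, 2, 4), (3, 2, -2), (-9, -4, -8), (3, -4, -2), (-9, 8, 4)]

theorem IsPrimitiveRoot.exists_cayley_mul_cayley_eq {ζ : ℂ} (hζ : IsPrimitiveRoot ζ 9) {a b : ℤ}
    (ha : ¬ (3 : ℤ) ∣ a) (hb : ¬ (3 : ℤ) ∣ b) :
    ∃ e ∈ [(1 : ℤ), -1], ∃ t ∈ cayleyProductCoords,
      3 * (cayley (ζ ^ a) * cayley (ζ ^ b)) =
        e * (t.1 + t.2.1 * (ζ - ζ ^ 2 - ζ ^ 5) + t.2.2 * (ζ ^ 4 + ζ ^ 5)) ∧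
      3 * (cayley (ζ ^ (3 * a)) * cayley (ζ ^ (3 * b))) = -e := by
  have hrel := hζ.ninth_root_relation
  obtain ⟨d, hd, hfa, hfa3⟩ := hζ.exists_cayley_zpow_eq ha
  obtain ⟨e, he, hfb, hfb3⟩ := hζ.exists_cayley_zpow_eq hb
  refine ⟨d * e, ?_, ?_⟩
  · simp only [List.mem_cons, List.not_mem_nil, or_false] at hd he ⊢
    rcases hd with rfl | rfl <;> rcases he with rfl | rfl <;> simp
  have hcube : 3 * (cayley (ζ ^ (3 * a)) * cayley (ζ ^ (3 * b))) = -((d * e : ℤ) : ℂ) := by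
    push_cast
    grind
  simp only [hcube, and_true, cayleyProductCoords, List.mem_cons, List.not_mem_nil, or_false,
    exists_eq_or_imp, exists_eq_left]
  have hprod (x y z : ℂ) (hx : 3 * cayley (ζ ^ a) = -d * x) (hy : 3 * cayley (ζ ^ b) = -e * y)
      (hz : x * y = 3 * z) : 3 * (cayley (ζ ^ a) * cayley (ζ ^ b)) = (d * e : ℤ) * z := by
    push_cast
    linear_combination (cayley (ζ ^ b)) * hx - (d * x / 3) * hy + (d * e / 3) * hz
  rcases hfa with hx | hx | hx <;> rcases hfb with hy | hy | hy
  · exact .inl (hprod _ _ _ hx hy (by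
      push_cast; linear_combination (4 * ζ ^ 4 + 8 * ζ ^ 3 + 12 * ζ ^ 2 + 20 * ζ + 28) * hrel))
  · exact .inr (.inl (hprod _ _ _ hx hy (by
      push_cast; linear_combination (-8 * ζ ^ 4 - 4 * ζ ^ 3 - 4 * ζ - 8) * hrel)))
  · exact .inr (.inr (.inl (hprod _ _ _ hx hy (by
      push_cast; linear_combination (4 * ζ ^ 4 - 4 * ζ ^ 3 - 4 * ζ - 8) * hrel))))
  · exact .inr (.inl (hprod _ _ _ hx hy (by
      push_cast; linear_combination (-8 * ζ ^ 4 - 4 * ζ ^ 3 - 4 * ζ - 8) * hrel)))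
  · exact .inr (.inr (.inr (.inl (hprod _ _ _ hx hy (by
      push_cast; linear_combination (16 * ζ ^ 4 - 16 * ζ ^ 3 - 12 * ζ ^ 2 + 8 * ζ + 28) * hrel)))))
  · exact .inr (.inr (.inr (.inr (.inl (hprod _ _ _ hx hy (by
      push_cast; linear_combination (-8 * ζ ^ 4 + 20 * ζ ^ 3 - 12 * ζ ^ 2 + 8 * ζ - 8) * hrel))))))
  · exact .inr (.inr (.inl (hprod _ _ _ hx hy (by
      push_cast; linear_combination (4 * ζ ^ 4 - 4 * ζ ^ 3 - 4 * ζ - 8) * hrel))))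
  · exact .inr (.inr (.inr (.inr (.inl (hprod _ _ _ hx hy (by
      push_cast; linear_combination (-8 * ζ ^ 4 + 20 * ζ ^ 3 - 12 * ζ ^ 2 + 8 * ζ - 8) * hrel))))))
  · exact .inr (.inr (.inr (.inr (.inr (hprod _ _ _ hx hy (by
      push_cast; linear_combination (4 * ζ ^ 4 - 16 * ζ ^ 3 + 24 * ζ ^ 2 - 28 * ζ + 28) * hrel))))))

theorem sign_sum_of_cayleyProductCoords_sum :
    ∀ u ∈ cayleyProductCoords, ∀ v ∈ cayleyProductCoords, ∀ w ∈ cayleyProductCoords,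
      ∀ d ∈ [(1 : ℤ), -1], ∀ e ∈ [(1 : ℤ), -1], ∀ f ∈ [(1 : ℤ), -1],
        d * u.1 + e * v.1 + f * w.1 - 3 = 0 → d * u.2.1 + e * v.2.1 + f * w.2.1 = 0 →
          d * u.2.2 + e * v.2.2 + f * w.2.2 = 0 → d + e + f = -3 := by
  decide +kernel

theorem stmt_8 (ζ : ℂ) (hζ : ζ = Complex.exp (2 * Real.pi * Complex.I / 9))
    (a b : Fin 3 → ℤ) (ha : ∀ i, ¬ (3 : ℤ) ∣ a i) (hb : ∀ i, ¬ (3 : ℤ) ∣ b i)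
    (h : ∑ i : Fin 3,
        ((ζ ^ (a i) + 1) / (ζ ^ (a i) - 1)) * ((ζ ^ (b i) + 1) / (ζ ^ (b i) - 1)) = 1) :
    ∑ i : Fin 3,
        ((ζ ^ (3 * a i) + 1) / (ζ ^ (3 * a i) - 1)) *
          ((ζ ^ (3 * b i) + 1) / (ζ ^ (3 * b i) - 1)) = 1 := by
  have hprim : IsPrimitiveRoot ζ 9 := by
    rw [hζ]
    exact_mod_cast Complex.isPrimitiveRoot_exp 9 (by norm_num)
  simp only [← cayley.eq_1, Fin.sum_univ_three] at h ⊢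
  obtain ⟨d, hd, u, hu, hu1, hu3⟩ := hprim.exists_cayley_mul_cayley_eq (ha 0) (hb 0)
  obtain ⟨e, he, v, hv, hv1, hv3⟩ := hprim.exists_cayley_mul_cayley_eq (ha 1) (hb 1)
  obtain ⟨f, hf, w, hw, hw1, hw3⟩ := hprim.exists_cayley_mul_cayley_eq (ha 2) (hb 2)
  obtain ⟨h0, h1, h2⟩ := hprim.eq_zero_of_ninth_real_combination
    (p := d * u.1 + e * v.1 + f * w.1 - 3) (q := d * u.2.1 + e * v.2.1 + f * w.2.1)
    (r := d * u.2.2 + e * v.2.2 + f * w.2.2)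
    (by push_cast; linear_combination 3 * h - hu1 - hv1 - hw1)
  have hsum : (d : ℂ) + e + f = -3 := by
    exact_mod_cast sign_sum_of_cayleyProductCoords_sum u hu v hv w hw d hd e he f hf h0 h1 h2
  linear_combination (hu3 + hv3 + hw3 - hsum) / 3
end

section
/- There exist integers a₁,…,a₈ and b₁,…,b₈, each not divisible by 3, such that, with ζ = exp(2πi/9) ∈ ℂ, Σ_{i=1}^{8} ((ζ^{a_i} + 1)/(ζ^{a_i} − 1)) · ((ζ^{b_i} + 1)/(ζ^{b_i} − 1)) = 6, but Σ_{i=1}^{8} ((ζ^{3a_i} + 1)/(ζ^{3a_i} − 1)) · ((ζ^{3b_i} + 1)/(ζ^{3b_i} − 1)) ≠ 6. -/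
theorem div_sub_one_eq_of_cyclotomic_nine {w : ℂ} (hw : w ^ 6 + w ^ 3 + 1 = 0) :
    (w + 1) / (w - 1) = -(2 * w ^ 5 + 2 * w ^ 4 + 2 * w ^ 3 + 4 * w ^ 2 + 4 * w + 1) / 3 := by
  have h1 : w - 1 ≠ 0 := by
    intro h
    rw [sub_eq_zero.mp h] at hw
    norm_num at hw
  rw [div_eq_iff h1]
  linear_combination (2 / 3) * hw

theorem div_sub_one_eq_of_cyclotomic_three {w : ℂ} (hw : w ^ 2 + w + 1 = 0) :
    (w + 1) / (w - 1) = -(2 * w + 1) / 3 := by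
  have h1 : w - 1 ≠ 0 := by
    intro h
    rw [sub_eq_zero.mp h] at hw
    norm_num at hw
  rw [div_eq_iff h1]
  linear_combination (2 / 3) * hw

theorem inv_add_one_div_inv_sub_one {w : ℂ} (hw : w ≠ 0) :
    (w⁻¹ + 1) / (w⁻¹ - 1) = -((w + 1) / (w - 1)) := by
  rw [← mul_div_mul_right _ _ hw, add_mul, sub_mul, inv_mul_cancel₀ hw, one_mul, add_comm,
    ← neg_sub w 1, div_neg]

theorem stmt_9 :
    ∃ a b : Fin 8 → ℤ, (∀ i, ¬ (3 : ℤ) ∣ a i) ∧ (∀ i, ¬ (3 : ℤ) ∣ b i) ∧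
      (∀ ζ : ℂ, ζ = Complex.exp (2 * Real.pi * Complex.I / 9) →
        (∑ i : Fin 8,
          ((ζ ^ (a i) + 1) / (ζ ^ (a i) - 1)) * ((ζ ^ (b i) + 1) / (ζ ^ (b i) - 1)) = 6) ∧
        (∑ i : Fin 8,
          ((ζ ^ (3 * a i) + 1) / (ζ ^ (3 * a i) - 1)) *
            ((ζ ^ (3 * b i) + 1) / (ζ ^ (3 * b i) - 1)) ≠ 6)) := by
  refine ⟨![1, 1, 1, 1, 1, 1, 1, 2], ![1, -2, -2, -2, -2, 4, 4, -2], by decide, by decide, ?_⟩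
  intro z hz
  have hprim : IsPrimitiveRoot z 9 := by
    rw [hz]
    exact_mod_cast Complex.isPrimitiveRoot_exp 9 (by norm_num)
  have h0 : z ≠ 0 := hprim.ne_zero (by norm_num)
  have h3 : z ^ 3 - 1 ≠ 0 :=
    sub_ne_zero.mpr (hprim.pow_ne_one_of_pos_of_lt (by norm_num) (by norm_num))
  have h : z ^ 6 + z ^ 3 + 1 = 0 := by
    apply (mul_eq_zero.mp _).resolve_left h3
    linear_combination hprim.pow_eq_one
  have e1 := div_sub_one_eq_of_cyclotomic_nine h
  have e2 := div_sub_one_eq_of_cyclotomic_nine (w := z ^ 2)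
    (by linear_combination (z ^ 6 - z ^ 3 + 1) * h)
  have e4 := div_sub_one_eq_of_cyclotomic_nine (w := z ^ 4)
    (by linear_combination (z ^ 6 - z ^ 3 + 1) * (z ^ 12 - z ^ 6 + 1) * h)
  have n2 : (z ^ (-2 : ℤ) + 1) / (z ^ (-2 : ℤ) - 1) = -((z ^ 2 + 1) / (z ^ 2 - 1)) := by
    rw [zpow_neg]
    exact inv_add_one_div_inv_sub_one (pow_ne_zero 2 h0)
  have d3 := div_sub_one_eq_of_cyclotomic_three (w := z ^ 3) (by linear_combination h)
  have d6 := div_sub_one_eq_of_cyclotomic_three (w := z ^ 6)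
    (by linear_combination (z ^ 6 - z ^ 3 + 1) * h)
  have d12 := div_sub_one_eq_of_cyclotomic_three (w := z ^ 12)
    (by linear_combination (z ^ 6 - z ^ 3 + 1) * (z ^ 12 - z ^ 6 + 1) * h)
  have n6 : (z ^ (-6 : ℤ) + 1) / (z ^ (-6 : ℤ) - 1) = -((z ^ 6 + 1) / (z ^ 6 - 1)) := by
    rw [zpow_neg]
    exact inv_add_one_div_inv_sub_one (pow_ne_zero 6 h0)
  have z2 : z ^ (2 : ℤ) = z ^ 2 := by norm_cast
  have z3 : z ^ (3 : ℤ) = z ^ 3 := by norm_cast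
  have z4 : z ^ (4 : ℤ) = z ^ 4 := by norm_cast
  have z6 : z ^ (6 : ℤ) = z ^ 6 := by norm_cast
  have z12 : z ^ (12 : ℤ) = z ^ 12 := by norm_cast
  constructor
  · simp only [Fin.sum_univ_eight, Matrix.cons_val]
    rw [n2, zpow_one, z2, z4, e1, e2, e4]
    linear_combination (8 / 9) *
      (z ^ 19 + z ^ 18 + z ^ 17 + z ^ 16 + 2 * z ^ 15 - z ^ 13 - 2 * z ^ 12 + 2 * z ^ 11 - z ^ 9
        - 5 * z ^ 8 + z ^ 7 - 5 * z ^ 6 - 3 * z ^ 5 - 8 * z ^ 4 + 3 * z ^ 3 - z ^ 2 - 7) * h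
  · simp only [Fin.sum_univ_eight, Matrix.cons_val]
    norm_num only
    rw [n6, z3, z6, z12, d3, d6, d12]
    intro H
    have : (8 : ℂ) = 0 := by
      linear_combination (8 / 9) * (z ^ 3 - 1) * (z ^ 6 - 2) * h - H
    norm_num at this
end

section
/- Let ζ = exp(2πi/9) ∈ ℂ. Then 2·((ζ+1)/(ζ−1))·((ζ^8+1)/(ζ^8−1)) + 3·((ζ+1)/(ζ−1))·((ζ^2+1)/(ζ^2−1)) + ((ζ+1)/(ζ−1))·((ζ^4+1)/(ζ^4−1)) + ((ζ^2+1)/(ζ^2−1))·((ζ^7+1)/(ζ^7−1)) + ((ζ^2+1)/(ζ^2−1))·((ζ^4+1)/(ζ^4−1)) = 6. -/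
/-- Since `Φ₉ = X ^ 6 + X ^ 3 + 1` takes the value `3` at `1`, division of `Φ₉ - 3` by `X - 1`
inverts `z - 1` at any root `z` of `Φ₉`. -/
theorem add_one_div_sub_one_of_cyclotomic_nine {z : ℂ} (h : z ^ 6 + z ^ 3 + 1 = 0) :
    (z + 1) / (z - 1) = 1 - 2 / 3 * (z ^ 5 + z ^ 4 + z ^ 3 + 2 * z ^ 2 + 2 * z + 2) := by
  have hz : z - 1 ≠ 0 := by
    intro h1
    rw [sub_eq_zero.mp h1] at h
    norm_num at h
  rw [div_eq_iff hz]
  linear_combination 2 / 3 * h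

theorem stmt_10 (ζ : ℂ) (hζ : ζ = Complex.exp (2 * Real.pi * Complex.I / 9)) :
    2 * ((ζ + 1) / (ζ - 1)) * ((ζ ^ 8 + 1) / (ζ ^ 8 - 1)) +
    3 * ((ζ + 1) / (ζ - 1)) * ((ζ ^ 2 + 1) / (ζ ^ 2 - 1)) +
    ((ζ + 1) / (ζ - 1)) * ((ζ ^ 4 + 1) / (ζ ^ 4 - 1)) +
    ((ζ ^ 2 + 1) / (ζ ^ 2 - 1)) * ((ζ ^ 7 + 1) / (ζ ^ 7 - 1)) +
    ((ζ ^ 2 + 1) / (ζ ^ 2 - 1)) * ((ζ ^ 4 + 1) / (ζ ^ 4 - 1)) = 6 := by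
  have hp : IsPrimitiveRoot ζ 9 := by
    rw [hζ]
    exact_mod_cast Complex.isPrimitiveRoot_exp 9 (by norm_num)
  have h9 : ζ ^ 9 = 1 := hp.pow_eq_one
  have h3 : ζ ^ 3 - 1 ≠ 0 :=
    sub_ne_zero.mpr (hp.pow_ne_one_of_pos_of_lt (by norm_num) (by norm_num))
  have h : ζ ^ 6 + ζ ^ 3 + 1 = 0 :=
    mul_left_cancel₀ h3 (by linear_combination h9)
  clear hζ hp h3
  rw [add_one_div_sub_one_of_cyclotomic_nine h,
    add_one_div_sub_one_of_cyclotomic_nine (z := ζ ^ 2) (by grind),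
    add_one_div_sub_one_of_cyclotomic_nine (z := ζ ^ 4) (by grind),
    add_one_div_sub_one_of_cyclotomic_nine (z := ζ ^ 7) (by grind),
    add_one_div_sub_one_of_cyclotomic_nine (z := ζ ^ 8) (by grind)]
  grind
end

section
/- In the integral group ring ℤ[C₂₅] of the cyclic group C₂₅ of order 25 with generator T, the 2 × 2 matrix [[45 + 16(T⁵ + T²⁰) + 16(T¹⁰ + T¹⁵), 93 + 23(T⁵ + T²⁰) + 23(T¹⁰ + T¹⁵)], [93 + 23(T⁵ + T²⁰) + 23(T¹⁰ + T¹⁵), 198 + 29(T⁵ + T²⁰) + 29(T¹⁰ + T¹⁵)]] has determinant equal to 1. -/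
open MonoidAlgebra

noncomputable def T : MonoidAlgebra ℤ (Multiplicative (ZMod 25)) :=
  MonoidAlgebra.of ℤ (Multiplicative (ZMod 25)) (Multiplicative.ofAdd (1 : ZMod 25))

theorem T_pow_twentyFive : T ^ 25 = 1 := by
  rw [T, ← map_pow, ← ofAdd_nsmul, show (25 : ℕ) • (1 : ZMod 25) = 0 by decide, ofAdd_zero, map_one]

theorem stmt_14 :
    Matrix.det
      !![45 + 16 * (T ^ 5 + T ^ 20) + 16 * (T ^ 10 + T ^ 15),
          93 + 23 * (T ^ 5 + T ^ 20) + 23 * (T ^ 10 + T ^ 15);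
         93 + 23 * (T ^ 5 + T ^ 20) + 23 * (T ^ 10 + T ^ 15),
          198 + 29 * (T ^ 5 + T ^ 20) + 29 * (T ^ 10 + T ^ 15)] = 1 := by
  rw [Matrix.det_fin_two_of]
  linear_combination (-65 * (T ^ 15 + 2 * T ^ 10 + 3 * T ^ 5 + 4)) * T_pow_twentyFive
end

section
/- Let M be the symmetric 10 × 10 integer matrix whose (i,j) block structure is as follows: writing M in 5 × 5 blocks, the upper-left block has diagonal entries 45 and off-diagonal entries 16; the lower-right block has diagonal entries 198 and off-diagonal entries 29; and the upper-right and lower-left blocks have diagonal entries 93 and off-diagonal entries 23 (that is, M[i][j] for 0 ≤ i,j ≤ 4 is 45 if i = j and 16 otherwise; M[i+5][j+5] is 198 if i = j and 29 otherwise; M[i][j+5] = M[j+5][i] is 93 if i = j and 23 otherwise). Then M is integrally congruent to the identity: there exists a 10 × 10 integer matrix U with det U = ±1 such that Uᵀ M U equals the 10 × 10 identity matrix. -/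
open Matrix

def M : Matrix (Fin 10) (Fin 10) ℤ :=
  Matrix.of fun i j =>
    if i.val < 5 then
      if j.val < 5 then (if i = j then 45 else 16)
      else (if j.val = i.val + 5 then 93 else 23)
    else
      if j.val < 5 then (if i.val = j.val + 5 then 93 else 23)
      else (if i = j then 198 else 29)

/-- A matrix whose columns are an orthonormal basis of the lattice with Gram matrix `M`. -/
def orthonormalBasisMatrix : Matrix (Fin 10) (Fin 10) ℤ :=
  Matrix.of fun i j =>
    if i.val < 5 then
      if j.val < 5 then (if i = j then 13 else 1)
      else (if j.val = i.val + 5 then -3 else 2)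
    else
      if j.val < 5 then (if i.val = j.val + 5 then -6 else -1)
      else (if i = j then 1 else -1)

theorem orthonormalBasisMatrix_transpose_mul_M_mul :
    orthonormalBasisMatrix.transpose * M * orthonormalBasisMatrix = 1 := by
  decide +kernel

theorem stmt_17 :
    ∃ U : Matrix (Fin 10) (Fin 10) ℤ, IsUnit U.det ∧ U.transpose * M * U = 1 := by
  exact ⟨orthonormalBasisMatrix,
    isUnit_det_of_left_inverse orthonormalBasisMatrix_transpose_mul_M_mul,
    orthonormalBasisMatrix_transpose_mul_M_mul⟩
end
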